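/- Let σ be a 2-pattern of length r with first letter σ₁ = 2, and for 0 ≤ j ≤ r set p_j(n) = ((−1)^{r−j}/2^{r−j+1})·(C(n,j) + (1/2)·C(n,j−1)), with the convention C(n,−1) = 0. Then for all integers n ≥ r and k ≥ 2 one has the identity (in ℚ): Σ_{π ∈ Π_n^k} occ_σ(π) = Σ_{j=0}^{r} p_j(n)·S_{n+2−j,k} − (1/2)·C(n,r)·S_{n+1−r,k} + ((−1)^{r+1}/2^{r+1})·S_{n,k−2}. -/

import Mathlib

open scoped Classical

def seg (n : ℕ) : Finset ℕ := Finset.Icc 1 n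

def IsPartition (P : Finset (Finset ℕ)) (S : Finset ℕ) : Prop :=
  ∅ ∉ P ∧ (∀ B ∈ P, ∀ C ∈ P, B ≠ C → Disjoint B C) ∧ P.biUnion id = S

noncomputable def partitions (n : ℕ) : Finset (Finset (Finset ℕ)) :=
  ((seg n).powerset.powerset).filter fun P => IsPartition P (seg n)

noncomputable def partitionsK (n k : ℕ) : Finset (Finset (Finset ℕ)) :=
  (partitions n).filter fun P => P.card = k

noncomputable def bell (n : ℕ) : ℕ := (partitions n).card

noncomputable def stirling (n k : ℕ) : ℕ := (partitionsK n k).card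

/-- `(i, j)` is an edge of the set partition `P`. -/
def IsEdge (P : Finset (Finset ℕ)) (i j : ℕ) : Prop :=
  i < j ∧ ∃ B ∈ P, i ∈ B ∧ j ∈ B ∧ ∀ p ∈ B, ¬(i < p ∧ p < j)

/-- `crol P`: number of linear crossings. -/
noncomputable def crol (P : Finset (Finset ℕ)) : ℕ :=
  Nat.card {e : (ℕ × ℕ) × ℕ × ℕ //
    IsEdge P e.1.1 e.1.2 ∧ IsEdge P e.2.1 e.2.2 ∧
      e.1.1 < e.2.1 ∧ e.2.1 < e.1.2 ∧ e.1.2 < e.2.2}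

/-- `(i, j)` is a circular edge of `P`. -/
def IsCircEdge (P : Finset (Finset ℕ)) (i j : ℕ) : Prop :=
  IsEdge P i j ∨
    ∃ B ∈ P, ∃ h : B.Nonempty, 2 ≤ B.card ∧ i = B.min' h ∧ j = B.max' h

/-- `croc P`: number of circular crossings. -/
noncomputable def croc (P : Finset (Finset ℕ)) : ℕ :=
  Nat.card {e : (ℕ × ℕ) × ℕ × ℕ //
    IsCircEdge P e.1.1 e.1.2 ∧ IsCircEdge P e.2.1 e.2.2 ∧
      e.1.1 < e.2.1 ∧ e.2.1 < e.1.2 ∧ e.1.2 < e.2.2}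

/-- Two blocks overlap: `min B < min B' < max B < max B'`. -/
def Overlap (B B' : Finset ℕ) : Prop :=
  ∃ (h : B.Nonempty) (h' : B'.Nonempty),
    B.min' h < B'.min' h' ∧ B'.min' h' < B.max' h ∧ B.max' h < B'.max' h'

/-- `ov P`: number of (unordered) pairs of blocks of `P` that overlap. -/
noncomputable def ov (P : Finset (Finset ℕ)) : ℕ :=
  Nat.card {p : Finset ℕ × Finset ℕ // p.1 ∈ P ∧ p.2 ∈ P ∧ Overlap p.1 p.2}

/-- Two blocks embrace: `min B < min B' ≤ max B' < max B`. -/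
def Embrace (B B' : Finset ℕ) : Prop :=
  ∃ (h : B.Nonempty) (h' : B'.Nonempty),
    B.min' h < B'.min' h' ∧ B'.min' h' ≤ B'.max' h' ∧ B'.max' h' < B.max' h

noncomputable def emb (P : Finset (Finset ℕ)) : ℕ :=
  Nat.card {p : Finset ℕ × Finset ℕ // p.1 ∈ P ∧ p.2 ∈ P ∧ Embrace p.1 p.2}

/-- The block of `P` containing `i`. -/
noncomputable def blockOf (P : Finset (Finset ℕ)) (i : ℕ) : Finset ℕ :=
  (P.filter fun B => i ∈ B).biUnion id

/-- The restricted growth function of `P`: `rgf P i = j` iff `i` lies in the `j`-th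
block of `P`, the blocks being ordered by increasing minima. -/
noncomputable def rgf (P : Finset (Finset ℕ)) (i : ℕ) : ℕ :=
  (P.filter fun B => B.min ≤ (blockOf P i).min).card

/-- A 2-pattern: a word on `{1,2}` containing both letters. -/
def TwoPattern {r : ℕ} (σ : Fin r → ℕ) : Prop :=
  (∀ t, σ t = 1 ∨ σ t = 2) ∧ (∃ t, σ t = 1) ∧ (∃ t, σ t = 2)

/-- `occ n σ P`: number of occurrences of the 2-pattern `σ` in the partition `P` of `[n]`. -/
noncomputable def occ (n : ℕ) {r : ℕ} (σ : Fin r → ℕ) (P : Finset (Finset ℕ)) : ℕ :=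
  Nat.card {i : Fin r → ℕ // StrictMono i ∧ (∀ t, i t ∈ seg n) ∧
    ∃ a b : ℕ, a < b ∧
      ∀ t, (σ t = 1 → rgf P (i t) = a) ∧ (σ t = 2 → rgf P (i t) = b)}

/-- Carlitz `q`-Stirling polynomials. -/
noncomputable def qS : ℕ → ℕ → Polynomial ℚ
  | 0, 0 => 1
  | 0, _ + 1 => 0
  | _ + 1, 0 => 0
  | n + 1, k + 1 =>
      Polynomial.X ^ k * qS n k +
        (∑ i ∈ Finset.range (k + 1), Polynomial.X ^ i) * qS n (k + 1)

/-- Standardization: the order preserving bijection `S → [|S|]`. -/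
def stdMap (S : Finset ℕ) (a : ℕ) : ℕ := (S.filter fun x => x ≤ a).card

/-- The standardized 2-block partition obtained from two blocks `A, B`. -/
def stdPair (A B : Finset ℕ) : Finset (Finset ℕ) :=
  {A.image (stdMap (A ∪ B)), B.image (stdMap (A ∪ B))}

theorem min_lt_min_iff_exists (X Y : Finset ℕ) :
    X.min < Y.min ↔ ∃ x ∈ X, ∀ y ∈ Y, x < y := by
  constructor
  · intro h
    obtain ⟨x, hx⟩ := WithTop.ne_top_iff_exists.1 (ne_top_of_lt h)
    refine ⟨x, Finset.mem_of_min hx.symm, fun y hy => ?_⟩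
    have := h.trans_le (Finset.min_le hy)
    rw [← hx] at this
    exact_mod_cast this
  · rintro ⟨x, hx, h⟩
    refine (Finset.min_le hx).trans_lt ?_
    rcases Y.eq_empty_or_nonempty with rfl | hY
    · simp
    · obtain ⟨y, hy⟩ := Finset.min_of_nonempty hY
      rw [hy]
      exact_mod_cast h y (Finset.mem_of_min hy)

/-- Set partitions of `S` with `k` blocks. -/
noncomputable def partsOf (S : Finset ℕ) (k : ℕ) : Finset (Finset (Finset ℕ)) :=
  S.powerset.powerset.filter fun P => IsPartition P S ∧ P.card = k

theorem mem_partsOf {S : Finset ℕ} {k : ℕ} {P : Finset (Finset ℕ)} :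
    P ∈ partsOf S k ↔ IsPartition P S ∧ P.card = k := by
  unfold partsOf
  rw [Finset.mem_filter, and_iff_right_iff_imp]
  rintro ⟨⟨-, -, h⟩, -⟩
  rw [Finset.mem_powerset]
  intro B hB
  rw [Finset.mem_powerset, ← h]
  exact Finset.subset_biUnion_of_mem id hB

theorem partitionsK_eq_partsOf (n k : ℕ) : partitionsK n k = partsOf (seg n) k := by
  ext P
  simp [partitionsK, partitions, partsOf, and_assoc]

theorem IsPartition.subset {P : Finset (Finset ℕ)} {S X : Finset ℕ} (h : IsPartition P S)
    (hX : X ∈ P) : X ⊆ S := by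
  rw [← h.2.2]
  exact Finset.subset_biUnion_of_mem id hX

theorem IsPartition.eq_of_mem {P : Finset (Finset ℕ)} {S X Y : Finset ℕ} (h : IsPartition P S)
    (hX : X ∈ P) (hY : Y ∈ P) {x : ℕ} (hxX : x ∈ X) (hxY : x ∈ Y) : X = Y := by
  by_contra hne
  exact Finset.disjoint_left.1 (h.2.1 X hX Y hY hne) hxX hxY

theorem IsPartition.exists_mem {P : Finset (Finset ℕ)} {S : Finset ℕ} (h : IsPartition P S)
    {x : ℕ} (hx : x ∈ S) : ∃ X ∈ P, x ∈ X := by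
  rw [← h.2.2] at hx
  simpa using hx

theorem IsPartition.erase {P : Finset (Finset ℕ)} {S X : Finset ℕ} (h : IsPartition P S)
    (hX : X ∈ P) : IsPartition (P.erase X) (S \ X) := by
  refine ⟨fun h0 => h.1 (Finset.mem_of_mem_erase h0), fun B hB C hC =>
    h.2.1 B (Finset.mem_of_mem_erase hB) C (Finset.mem_of_mem_erase hC), ?_⟩
  ext x
  simp only [Finset.mem_biUnion, Finset.mem_erase, id, Finset.mem_sdiff]
  constructor
  · rintro ⟨B, ⟨hne, hB⟩, hx⟩
    exact ⟨h.subset hB hx, fun hxX => hne (h.eq_of_mem hB hX hx hxX)⟩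
  · rintro ⟨hx, hxX⟩
    obtain ⟨B, hB, hxB⟩ := h.exists_mem hx
    exact ⟨B, ⟨fun e => hxX (e ▸ hxB), hB⟩, hxB⟩

theorem IsPartition.notMem_of_sdiff {P : Finset (Finset ℕ)} {S X : Finset ℕ}
    (h : IsPartition P (S \ X)) (hX : X.Nonempty) : X ∉ P := by
  intro hXP
  obtain ⟨x, hx⟩ := hX
  exact (Finset.mem_sdiff.1 (h.subset hXP hx)).2 hx

theorem IsPartition.insert {P : Finset (Finset ℕ)} {S X : Finset ℕ}
    (h : IsPartition P (S \ X)) (hX : X.Nonempty) (hXS : X ⊆ S) :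
    IsPartition (insert X P) S := by
  have hd : ∀ B ∈ P, Disjoint B X := fun B hB =>
    Finset.disjoint_of_subset_left (h.subset hB) Finset.sdiff_disjoint
  refine ⟨?_, ?_, ?_⟩
  · rw [Finset.mem_insert, not_or]
    exact ⟨hX.ne_empty.symm, h.1⟩
  · intro B hB C hC hne
    rcases Finset.mem_insert.1 hB with rfl | hB <;> rcases Finset.mem_insert.1 hC with rfl | hC
    · exact absurd rfl hne
    · exact (hd C hC).symm
    · exact hd B (by assumption)
    · exact h.2.1 B hB C hC hne
  · rw [Finset.biUnion_insert, h.2.2, id, Finset.union_sdiff_of_subset hXS]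

theorem card_partsOf_filter_mem {S X : Finset ℕ} (hX : X.Nonempty) (hXS : X ⊆ S) (k : ℕ)
    {p q : Finset (Finset ℕ) → Prop} [DecidablePred p] [DecidablePred q]
    (hq : ∀ P, q P ↔ X ∈ P ∧ p (P.erase X)) :
    ((partsOf S (k + 1)).filter q).card = ((partsOf (S \ X) k).filter p).card := by
  refine Finset.card_nbij' (fun P => P.erase X) (fun P => insert X P) ?_ ?_ ?_ ?_
  · intro P hP
    simp only [Finset.coe_filter, Set.mem_ofPred_eq, mem_partsOf, hq] at hP ⊢
    obtain ⟨⟨h, hc⟩, hXP, hp⟩ := hP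
    exact ⟨⟨h.erase hXP, by rw [Finset.card_erase_of_mem hXP, hc]; rfl⟩, hp⟩
  · intro P hP
    simp only [Finset.coe_filter, Set.mem_ofPred_eq, mem_partsOf, hq] at hP ⊢
    obtain ⟨⟨h, hc⟩, hp⟩ := hP
    have hn := h.notMem_of_sdiff hX
    exact ⟨⟨h.insert hX hXS, by rw [Finset.card_insert_of_notMem hn, hc]⟩,
      Finset.mem_insert_self _ _, by rwa [Finset.erase_insert hn]⟩
  · intro P hP
    simp only [Finset.coe_filter, Set.mem_ofPred_eq, hq] at hP
    exact Finset.insert_erase hP.2.1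
  · intro P hP
    simp only [Finset.coe_filter, Set.mem_ofPred_eq, mem_partsOf] at hP
    exact Finset.erase_insert (hP.1.1.notMem_of_sdiff hX)

/-- Stirling numbers of the second kind `stirlingRec k n = S(n, k)`, computed by
removing the block of a fixed element. -/
def stirlingRec : ℕ → ℕ → ℕ
  | 0, 0 => 1
  | 0, _ + 1 => 0
  | _ + 1, 0 => 0
  | k + 1, n + 1 => ∑ i ∈ Finset.range (n + 1), n.choose i * stirlingRec k (n - i)

theorem card_partsOf (k : ℕ) : ∀ S : Finset ℕ, (partsOf S k).card = stirlingRec k S.card := by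
  induction k with
  | zero =>
    intro S
    rcases S.eq_empty_or_nonempty with rfl | hS
    · have : partsOf ∅ 0 = {∅} := by
        ext P
        rw [mem_partsOf, Finset.mem_singleton, Finset.card_eq_zero]
        refine ⟨fun h => h.2, ?_⟩
        rintro rfl
        simp [IsPartition]
      simp [this, stirlingRec]
    · have : partsOf S 0 = ∅ := by
        ext P
        rw [mem_partsOf, Finset.card_eq_zero]
        simp only [Finset.notMem_empty, iff_false]
        rintro ⟨h, rfl⟩
        obtain ⟨x, hx⟩ := hS
        simpa using h.exists_mem hx
      obtain ⟨c, hc⟩ := Nat.exists_eq_succ_of_ne_zero (Finset.card_ne_zero.2 hS)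
      simp [this, hc, stirlingRec]
  | succ k ih =>
    intro S
    rcases S.eq_empty_or_nonempty with rfl | ⟨x, hx⟩
    · have : partsOf ∅ (k + 1) = ∅ := by
        ext P
        rw [mem_partsOf]
        simp only [Finset.notMem_empty, iff_false]
        rintro ⟨h, hc⟩
        obtain ⟨X, hX⟩ := Finset.card_pos.1 (hc.symm ▸ Nat.succ_pos k : 0 < P.card)
        exact h.1 (Finset.subset_empty.1 (h.subset hX) ▸ hX)
      simp [this, stirlingRec]
    · have hd : partsOf S (k + 1) = (S.erase x).powerset.biUnion fun U =>
          (partsOf S (k + 1)).filter fun P => insert x U ∈ P := by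
        ext P
        simp only [Finset.mem_biUnion, Finset.mem_powerset, Finset.mem_filter]
        refine ⟨fun hP => ?_, fun ⟨U, _, hP, _⟩ => hP⟩
        obtain ⟨X, hX, hxX⟩ := (mem_partsOf.1 hP).1.exists_mem hx
        exact ⟨X.erase x, Finset.erase_subset_erase x ((mem_partsOf.1 hP).1.subset hX), hP, by
          rwa [Finset.insert_erase hxX]⟩
      rw [hd, Finset.card_biUnion]
      · have hterm : ∀ U ∈ (S.erase x).powerset,
            ((partsOf S (k + 1)).filter fun P => insert x U ∈ P).card
              = stirlingRec k ((S.erase x).card - U.card) := by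
          intro U hU
          rw [Finset.mem_powerset] at hU
          have hxU : x ∉ U := fun h => Finset.notMem_erase x S (hU h)
          have hsub : insert x U ⊆ S :=
            Finset.insert_subset hx (hU.trans (Finset.erase_subset _ _))
          rw [card_partsOf_filter_mem (Finset.insert_nonempty x U) hsub k
            (p := fun _ => True) (fun P => by simp), Finset.filter_true, ih,
            Finset.card_sdiff_of_subset hsub,
            Finset.card_insert_of_notMem hxU, Finset.card_erase_of_mem hx]
          congr 1
          omega
        rw [Finset.sum_congr rfl hterm,
          Finset.sum_powerset_apply_card (fun i => stirlingRec k ((S.erase x).card - i)),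
          ← Finset.card_erase_add_one hx, stirlingRec]
        simp
      · intro U hU V hV hne
        rw [Function.onFun, Finset.disjoint_left]
        intro P hP hP'
        rw [Finset.mem_filter, mem_partsOf] at hP hP'
        simp only [Finset.coe_powerset, Set.mem_preimage, Set.mem_powerset_iff,
          Finset.coe_subset] at hU hV
        apply hne
        have := hP.1.1.eq_of_mem hP.2 hP'.2 (Finset.mem_insert_self x U)
          (Finset.mem_insert_self x V)
        rw [← Finset.erase_insert (fun h => Finset.notMem_erase x S (hU h)), this,
          Finset.erase_insert (fun h => Finset.notMem_erase x S (hV h))]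

theorem stirling_eq_stirlingRec (n k : ℕ) : stirling n k = stirlingRec k n := by
  rw [stirling, partitionsK_eq_partsOf, card_partsOf, seg, Nat.card_Icc, Nat.add_sub_cancel]

theorem card_partsOf_filter_mem_mem {S X Y : Finset ℕ} (hX : X.Nonempty) (hY : Y.Nonempty)
    (hXS : X ⊆ S) (hYS : Y ⊆ S) (hXY : Disjoint X Y) (k : ℕ) :
    ((partsOf S (k + 2)).filter fun P => X ∈ P ∧ Y ∈ P).card
      = stirlingRec k (S.card - (X.card + Y.card)) := by
  have hne : Y ≠ X := by
    rintro rfl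
    exact hY.ne_empty (disjoint_self.1 hXY)
  have hYS' : Y ⊆ S \ X := Finset.subset_sdiff.2 ⟨hYS, hXY.symm⟩
  rw [card_partsOf_filter_mem hX hXS (k + 1) (p := fun Q => Y ∈ Q)
      (fun P => by simp [Finset.mem_erase, hne]),
    card_partsOf_filter_mem hY hYS' k (p := fun _ => True) (fun P => by simp),
    Finset.filter_true, card_partsOf, Finset.card_sdiff_of_subset hYS',
    Finset.card_sdiff_of_subset hXS, Nat.sub_sub]

theorem two_mul_card_filter_min_lt {A B U : Finset ℕ} {m : ℕ} (hm : m ∈ B)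
    (hA : ∀ x ∈ A, m ≤ x) (hB : ∀ x ∈ B, m ≤ x) :
    2 * (U.powerset.filter fun V => (A ∪ V).min < (B ∪ (U \ V)).min).card
      = if ∃ u ∈ U, u < m then 2 ^ U.card else 0 := by
  simp only [min_lt_min_iff_exists]
  split_ifs with h
  · obtain ⟨u, hu, hum⟩ := h
    obtain ⟨z, hz, hzmin⟩ := U.exists_min_image id ⟨u, hu⟩
    simp only [id] at hzmin
    have hzm : z < m := (hzmin u hu).trans_lt hum
    have he : (U.powerset.filter fun V => ∃ x ∈ A ∪ V, ∀ y ∈ B ∪ (U \ V), x < y)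
        = Finset.Icc {z} U := by
      ext V
      simp only [Finset.mem_filter, Finset.mem_powerset, Finset.mem_Icc,
        Finset.singleton_subset_iff, Finset.mem_union, Finset.mem_sdiff]
      rw [and_comm (a := z ∈ V)]
      refine and_congr_right fun hV => ⟨?_, fun hzV => ⟨z, Or.inr hzV, ?_⟩⟩
      · rintro ⟨x, hx, hxy⟩
        by_contra hzV
        have h1 := hxy z (Or.inr ⟨hz, hzV⟩)
        rcases hx with hx | hx
        · have := hA x hx
          omega
        · have := hzmin x (hV hx)
          omega
      · rintro y (hy | ⟨hyU, hyV⟩)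
        · exact hzm.trans_le (hB y hy)
        · exact (hzmin y hyU).lt_of_ne (fun e => hyV (e ▸ hzV))
    rw [he, Finset.card_Icc_finset (Finset.singleton_subset_iff.2 hz), Finset.card_singleton,
      ← pow_succ', Nat.sub_add_cancel (Finset.card_pos.2 ⟨u, hu⟩)]
  · push Not at h
    rw [Finset.filter_eq_empty_iff.2, Finset.card_empty, mul_zero]
    rintro V hV ⟨x, hx, hxy⟩
    have h1 := hxy m (Finset.mem_union_left _ hm)
    rcases Finset.mem_union.1 hx with hx | hx
    · have := hA x hx
      omega
    · have := h x (Finset.mem_powerset.1 hV hx)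
      omega

theorem card_partsOf_filter_min_lt {S A B : Finset ℕ} (hA : A.Nonempty) (hB : B.Nonempty)
    (hAS : A ⊆ S) (hBS : B ⊆ S) (hAB : Disjoint A B) (k : ℕ) :
    ((partsOf S (k + 2)).filter fun P =>
        ∃ X ∈ P, ∃ Y ∈ P, X.min < Y.min ∧ A ⊆ X ∧ B ⊆ Y).card
      = ∑ U ∈ (S \ (A ∪ B)).powerset,
          (U.powerset.filter fun V => (A ∪ V).min < (B ∪ (U \ V)).min).card
            * stirlingRec k ((S \ (A ∪ B)).card - U.card) := by
  have hmem : ∀ {U V : Finset ℕ}, U ⊆ S \ (A ∪ B) → V ⊆ U →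
      Disjoint A V ∧ Disjoint B V ∧ Disjoint A (U \ V) ∧ Disjoint B (U \ V) := by
    intro U V hU hV
    have h : Disjoint (A ∪ B) U := (Finset.subset_sdiff.1 hU).2.symm
    rw [Finset.disjoint_union_left] at h
    exact ⟨h.1.mono_right hV, h.2.mono_right hV, h.1.mono_right Finset.sdiff_subset,
      h.2.mono_right Finset.sdiff_subset⟩
  set D := (S \ (A ∪ B)).powerset.sigma fun U =>
    U.powerset.filter fun V => (A ∪ V).min < (B ∪ (U \ V)).min with hD
  have hd : ((partsOf S (k + 2)).filter fun P =>
        ∃ X ∈ P, ∃ Y ∈ P, X.min < Y.min ∧ A ⊆ X ∧ B ⊆ Y)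
      = D.biUnion fun q => (partsOf S (k + 2)).filter fun P =>
          A ∪ q.2 ∈ P ∧ B ∪ (q.1 \ q.2) ∈ P := by
    ext P
    simp only [hD, Finset.mem_biUnion, Finset.mem_sigma, Finset.mem_filter, Finset.mem_powerset]
    constructor
    · rintro ⟨hP, X, hX, Y, hY, hlt, hAX, hBY⟩
      have hp := (mem_partsOf.1 hP).1
      have hXY : Disjoint X Y := hp.2.1 X hX Y hY (fun e => hlt.ne (e ▸ rfl))
      have h1 : A ∪ X \ A = X := Finset.union_sdiff_of_subset hAX
      have h2 : B ∪ ((X ∪ Y) \ (A ∪ B)) \ (X \ A) = Y := by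
        ext x
        have := @hAX x
        have := @hBY x
        have : x ∈ X → x ∉ Y := fun h => Finset.disjoint_left.1 hXY h
        simp only [Finset.mem_union, Finset.mem_sdiff]
        tauto
      refine ⟨⟨(X ∪ Y) \ (A ∪ B), X \ A⟩, ⟨?_, ?_, ?_⟩, hP, ?_, ?_⟩
      · exact Finset.sdiff_subset_sdiff (Finset.union_subset (hp.subset hX) (hp.subset hY))
          le_rfl
      · intro x
        have := @hBY x
        have : x ∈ X → x ∉ Y := fun h => Finset.disjoint_left.1 hXY h
        simp only [Finset.mem_union, Finset.mem_sdiff]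
        tauto
      · simp only [h1, h2, hlt]
      · simpa only [h1] using hX
      · simpa only [h2] using hY
    · rintro ⟨⟨U, V⟩, ⟨hU, hV, hlt⟩, hP, h1, h2⟩
      exact ⟨hP, _, h1, _, h2, hlt, Finset.subset_union_left, Finset.subset_union_left⟩
  rw [hd, Finset.card_biUnion]
  · have hterm : ∀ q ∈ D, ((partsOf S (k + 2)).filter fun P =>
          A ∪ q.2 ∈ P ∧ B ∪ (q.1 \ q.2) ∈ P).card
        = stirlingRec k ((S \ (A ∪ B)).card - q.1.card) := by
      rintro ⟨U, V⟩ hq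
      simp only [hD, Finset.mem_sigma, Finset.mem_filter, Finset.mem_powerset] at hq
      obtain ⟨hU, hV, -⟩ := hq
      obtain ⟨d1, d2, d3, d4⟩ := hmem hU hV
      have hUS : U ⊆ S := hU.trans Finset.sdiff_subset
      rw [card_partsOf_filter_mem_mem (hA.mono Finset.subset_union_left)
        (hB.mono Finset.subset_union_left) (Finset.union_subset hAS (hV.trans hUS))
        (Finset.union_subset hBS (Finset.sdiff_subset.trans hUS))]
      · rw [Finset.card_union_of_disjoint d1, Finset.card_union_of_disjoint d4,
          Finset.card_sdiff_of_subset hV,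
          Finset.card_sdiff_of_subset (Finset.union_subset hAS hBS),
          Finset.card_union_of_disjoint hAB]
        have := Finset.card_le_card hV
        congr 1
        simp only
        omega
      · rw [Finset.disjoint_union_left, Finset.disjoint_union_right, Finset.disjoint_union_right]
        exact ⟨⟨hAB, d3⟩, d2.symm, Finset.disjoint_sdiff⟩
    rw [Finset.sum_congr rfl hterm, hD, Finset.sum_sigma]
    refine Finset.sum_congr rfl fun U _ => ?_
    simp only [Finset.sum_const, smul_eq_mul]
  · rintro ⟨U, V⟩ hq ⟨U', V'⟩ hq' hne
    rw [Function.onFun, Finset.disjoint_left]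
    intro P hP hP'
    simp only [Finset.mem_filter, mem_partsOf] at hP hP'
    simp only [hD, Finset.mem_coe, Finset.mem_sigma, Finset.mem_filter,
      Finset.mem_powerset] at hq hq'
    obtain ⟨d1, -, -, d4⟩ := hmem hq.1 hq.2.1
    obtain ⟨d1', -, -, d4'⟩ := hmem hq'.1 hq'.2.1
    obtain ⟨a, ha⟩ := hA
    obtain ⟨b, hb⟩ := hB
    have e1 := hP.1.1.eq_of_mem hP.2.1 hP'.2.1 (Finset.mem_union_left _ ha)
      (Finset.mem_union_left _ ha)
    have e2 := hP.1.1.eq_of_mem hP.2.2 hP'.2.2 (Finset.mem_union_left _ hb)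
      (Finset.mem_union_left _ hb)
    have hV : V = V' := by
      rw [← Finset.union_sdiff_cancel_left d1, e1, Finset.union_sdiff_cancel_left d1']
    have hU : U \ V = U' \ V' := by
      rw [← Finset.union_sdiff_cancel_left d4, e2, Finset.union_sdiff_cancel_left d4']
    apply hne
    rw [← Finset.union_sdiff_of_subset hq.2.1, hU, hV,
      Finset.union_sdiff_of_subset hq'.2.1]

/-- The binomial transform `∑ i, C(h, i) cⁱ g(h - i)`. -/
def binomSum (c : ℕ) (g : ℕ → ℕ) (h : ℕ) : ℕ :=
  ∑ i ∈ Finset.range (h + 1), h.choose i * (c ^ i * g (h - i))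

theorem binomSum_zero (c : ℕ) (g : ℕ → ℕ) : binomSum c g 0 = g 0 := by
  simp [binomSum]

theorem binomSum_succ (c : ℕ) (g : ℕ → ℕ) (h : ℕ) :
    binomSum c g (h + 1) = binomSum c (fun j => g (j + 1)) h + c * binomSum c g h := by
  have hr : binomSum c (fun j => g (j + 1)) h
      = ∑ i ∈ Finset.range (h + 2), h.choose i * (c ^ i * g (h + 1 - i)) := by
    rw [Finset.sum_range_succ, Nat.choose_succ_self, zero_mul, add_zero, binomSum]
    refine Finset.sum_congr rfl fun i hi => ?_
    rw [Nat.sub_add_comm (Finset.mem_range_succ_iff.1 hi)]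
  rw [hr, binomSum, Finset.sum_range_succ', Finset.sum_range_succ' _ (h + 1), binomSum,
    Finset.mul_sum, add_right_comm, ← Finset.sum_add_distrib]
  congr 1
  · refine Finset.sum_congr rfl fun i _ => ?_
    rw [Nat.choose_succ_succ, Nat.add_sub_add_right, pow_succ]
    ring
  · simp

theorem binomSum_add (c : ℕ) (f g : ℕ → ℕ) (h : ℕ) :
    binomSum c (fun j => f j + g j) h = binomSum c f h + binomSum c g h := by
  simp only [binomSum, mul_add, Finset.sum_add_distrib]

theorem binomSum_one_binomSum_one (h : ℕ) :
    ∀ g : ℕ → ℕ, binomSum 1 (binomSum 1 g) h = binomSum 2 g h := by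
  induction h with
  | zero => simp [binomSum_zero]
  | succ h ih =>
    intro g
    rw [binomSum_succ, binomSum_succ 2]
    simp only [binomSum_succ 1 g, one_mul, binomSum_add]
    rw [ih, ih]
    ring

theorem sum_powerset_two_pow_mul (T : Finset ℕ) (g : ℕ → ℕ) :
    ∑ U ∈ T.powerset, 2 ^ U.card * g (T.card - U.card) = binomSum 2 g T.card := by
  rw [Finset.sum_powerset_apply_card (fun i => 2 ^ i * g (T.card - i))]
  simp [binomSum]

theorem stirlingRec_succ_succ (k n : ℕ) :
    stirlingRec (k + 1) (n + 1) = binomSum 1 (stirlingRec k) n := by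
  simp [stirlingRec, binomSum]

/-- The number of ways to choose disjoint `A, B ⊆ [h]` and a partition into `k` blocks of the
complement of `A ∪ B` in a set of size `l + h`. -/
def pairExt (k l h : ℕ) : ℕ :=
  binomSum 2 (fun j => stirlingRec k (l + j)) h

theorem pairExt_zero_right (k l : ℕ) : pairExt k l 0 = stirlingRec k l := by
  simp [pairExt, binomSum_zero]

theorem pairExt_succ (k l h : ℕ) :
    pairExt k l (h + 1) = pairExt k (l + 1) h + 2 * pairExt k l h := by
  rw [pairExt, binomSum_succ]
  simp only [pairExt, add_assoc, add_comm 1]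

theorem pairExt_zero_left (k h : ℕ) :
    stirlingRec (k + 2) (h + 2) = pairExt k 0 h + stirlingRec (k + 2) (h + 1) := by
  rw [stirlingRec_succ_succ, stirlingRec_succ_succ, binomSum_succ, one_mul]
  simp only [stirlingRec_succ_succ, pairExt, zero_add]
  rw [binomSum_one_binomSum_one]

theorem two_mul_card_partsOf_filter_min_lt {S A B : Finset ℕ} {m : ℕ} (hA : A.Nonempty)
    (hAS : A ⊆ S) (hBS : B ⊆ S) (hAB : Disjoint A B) (hm : m ∈ B)
    (hAm : ∀ x ∈ A, m ≤ x) (hBm : ∀ x ∈ B, m ≤ x) (k l h : ℕ)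
    (hl : ((S \ (A ∪ B)).filter fun x => x < m).card = l)
    (hh : ((S \ (A ∪ B)).filter fun x => ¬ x < m).card = h) :
    2 * ((partsOf S (k + 2)).filter fun P =>
        ∃ X ∈ P, ∃ Y ∈ P, X.min < Y.min ∧ A ⊆ X ∧ B ⊆ Y).card + pairExt k l h
      = pairExt k 0 (l + h) := by
  have hc : (S \ (A ∪ B)).card = l + h := by
    rw [← hl, ← hh, Finset.card_filter_add_card_filter_not]
  rw [card_partsOf_filter_min_lt hA ⟨m, hm⟩ hAS hBS hAB, Finset.mul_sum, hc]
  simp only [← mul_assoc, two_mul_card_filter_min_lt hm hAm hBm, ite_mul, zero_mul]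
  have hlow : pairExt k l h = ∑ U ∈ (S \ (A ∪ B)).powerset,
      if ∃ u ∈ U, u < m then 0 else 2 ^ U.card * stirlingRec k (l + h - U.card) := by
    have hf : ((S \ (A ∪ B)).powerset.filter fun U => ¬ ∃ u ∈ U, u < m)
        = ((S \ (A ∪ B)).filter fun x => ¬ x < m).powerset := by
      ext U
      simp only [Finset.mem_filter, Finset.mem_powerset, Finset.subset_iff, not_exists, not_and]
      exact ⟨fun H x hx => ⟨H.1 hx, H.2 x hx⟩, fun H => ⟨fun x hx => (H hx).1,
        fun x hx => (H hx).2⟩⟩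
    simp only [← ite_not (∃ u ∈ _, u < m)]
    rw [← Finset.sum_filter, hf, pairExt]
    conv_lhs => rw [← hh]
    rw [← sum_powerset_two_pow_mul, hh]
    refine Finset.sum_congr rfl fun U hU => ?_
    rw [Nat.add_sub_assoc (hh ▸ Finset.card_le_card (Finset.mem_powerset.1 hU))]
  rw [hlow, ← Finset.sum_add_distrib, pairExt]
  simp only [zero_add]
  rw [← hc, ← sum_powerset_two_pow_mul]
  refine Finset.sum_congr rfl fun U _ => ?_
  split_ifs <;> simp

/-- `∑_{l + h = N} C(h + q, q) · pairExt k l h`. -/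
def weightedPairExt (k q N : ℕ) : ℚ :=
  ∑ p ∈ Finset.HasAntidiagonal.antidiagonal N, ((p.2 + q).choose q : ℚ) * pairExt k p.1 p.2

theorem two_mul_pairExt (k l h : ℕ) :
    2 * (pairExt k l h : ℚ) = pairExt k l (h + 1) - pairExt k (l + 1) h := by
  rw [pairExt_succ]
  push_cast
  ring

theorem two_mul_weightedPairExt (k q N : ℕ) :
    2 * weightedPairExt k q N
      = ∑ p ∈ Finset.HasAntidiagonal.antidiagonal N,
          ((p.2 + q).choose q : ℚ) * pairExt k p.1 (p.2 + 1)
        - ∑ p ∈ Finset.HasAntidiagonal.antidiagonal N,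
          ((p.2 + q).choose q : ℚ) * pairExt k (p.1 + 1) p.2 := by
  rw [weightedPairExt, Finset.mul_sum, ← Finset.sum_sub_distrib]
  refine Finset.sum_congr rfl fun p _ => ?_
  rw [mul_left_comm, two_mul_pairExt]
  ring

theorem two_mul_weightedPairExt_zero (k N : ℕ) :
    2 * weightedPairExt k 0 N = pairExt k 0 (N + 1) - stirlingRec k (N + 1) := by
  have h1 := Finset.Nat.sum_antidiagonal_succ (n := N) (f := fun p => (pairExt k p.1 p.2 : ℚ))
  have h2 := Finset.Nat.sum_antidiagonal_succ' (n := N) (f := fun p => (pairExt k p.1 p.2 : ℚ))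
  rw [pairExt_zero_right] at h2
  simp only [two_mul_weightedPairExt, Nat.choose_zero_right, Nat.cast_one, one_mul]
  linarith

theorem two_mul_weightedPairExt_succ (k q N : ℕ) :
    2 * weightedPairExt k (q + 1) N
      = ((N + 1 + (q + 1)).choose (q + 1) : ℚ) * pairExt k 0 (N + 1)
        - weightedPairExt k q (N + 1) := by
  have h1 := Finset.Nat.sum_antidiagonal_succ (n := N)
    (f := fun p => ((p.2 + (q + 1)).choose (q + 1) : ℚ) * pairExt k p.1 p.2)
  have h2 := Finset.Nat.sum_antidiagonal_succ' (n := N)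
    (f := fun p => ((p.2 + (q + 1)).choose (q + 1) : ℚ) * pairExt k p.1 p.2)
  have h3 := Finset.Nat.sum_antidiagonal_succ' (n := N)
    (f := fun p => ((p.2 + q).choose q : ℚ) * pairExt k p.1 p.2)
  have hp : ∀ c : ℕ, ((c + 1 + (q + 1)).choose (q + 1) : ℚ)
      = ((c + (q + 1)).choose (q + 1) : ℚ) + ((c + 1 + q).choose q : ℚ) := by
    intro c
    rw [show c + 1 + (q + 1) = c + q + 1 + 1 by ring, Nat.choose_succ_succ,
      show c + (q + 1) = c + q + 1 by ring, show c + 1 + q = c + q + 1 by ring]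
    push_cast
    ring
  simp only [zero_add, Nat.choose_self, Nat.cast_one, one_mul] at h2 h3
  have h4 : ∑ p ∈ Finset.HasAntidiagonal.antidiagonal N,
        ((p.2 + 1 + (q + 1)).choose (q + 1) : ℚ) * pairExt k p.1 (p.2 + 1)
      = ∑ p ∈ Finset.HasAntidiagonal.antidiagonal N, ((p.2 + (q + 1)).choose (q + 1) : ℚ)
          * pairExt k p.1 (p.2 + 1)
        + ∑ p ∈ Finset.HasAntidiagonal.antidiagonal N, ((p.2 + 1 + q).choose q : ℚ)
          * pairExt k p.1 (p.2 + 1) := by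
    rw [← Finset.sum_add_distrib]
    refine Finset.sum_congr rfl fun p _ => ?_
    rw [hp, add_mul]
  rw [two_mul_weightedPairExt, weightedPairExt]
  linarith

/-- The closed form on the right-hand side of the occurrence identity. -/
def occClosedForm (k n r : ℕ) : ℚ :=
  (∑ j ∈ Finset.range (r + 1), ((-1 : ℚ) ^ (r - j) / 2 ^ (r - j + 1)) *
      ((n.choose j : ℚ) + (1 / 2) * (if j = 0 then 0 else (n.choose (j - 1) : ℚ)))
        * (stirlingRec (k + 2) (n + 2 - j) : ℚ))
    - (1 / 2) * (n.choose r : ℚ) * (stirlingRec (k + 2) (n + 1 - r) : ℚ)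
    + ((-1 : ℚ) ^ (r + 1) / 2 ^ (r + 1)) * (stirlingRec k n : ℚ)

theorem occClosedForm_zero (k n : ℕ) :
    occClosedForm k n 0 = (1 / 2) * pairExt k 0 n - (1 / 2) * stirlingRec k n := by
  have h : (stirlingRec (k + 2) (n + 2) : ℚ)
      = pairExt k 0 n + stirlingRec (k + 2) (n + 1) := by
    exact_mod_cast pairExt_zero_left k n
  simp [occClosedForm, h]
  ring

theorem occClosedForm_succ (k n r : ℕ) (hr : r + 1 ≤ n) :
    occClosedForm k n (r + 1) = (1 / 2) * (n.choose (r + 1) : ℚ) * pairExt k 0 (n - (r + 1))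
      - (1 / 2) * occClosedForm k n r := by
  obtain ⟨d, rfl⟩ := Nat.exists_eq_add_of_le hr
  have h : (stirlingRec (k + 2) (d + 2) : ℚ)
      = pairExt k 0 d + stirlingRec (k + 2) (d + 1) := by
    exact_mod_cast pairExt_zero_left k d
  have hs : ∀ a : ℕ → ℚ, ∑ j ∈ Finset.range (r + 1),
        ((-1 : ℚ) ^ (r + 1 - j) / 2 ^ (r + 1 - j + 1)) * a j
      = -(1 / 2) * ∑ j ∈ Finset.range (r + 1), ((-1 : ℚ) ^ (r - j) / 2 ^ (r - j + 1)) * a j := by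
    intro a
    rw [Finset.mul_sum]
    refine Finset.sum_congr rfl fun j hj => ?_
    rw [Nat.sub_add_comm (Finset.mem_range_succ_iff.1 hj)]
    field_simp
    ring
  simp only [occClosedForm, mul_assoc]
  rw [Finset.sum_range_succ _ (r + 1), hs]
  rw [show r + 1 + d + 2 - (r + 1) = d + 2 by omega, show r + 1 + d + 1 - (r + 1) = d + 1 by omega,
    show r + 1 + d + 1 - r = d + 2 by omega, show r + 1 + d - (r + 1) = d by omega, h]
  simp only [Nat.sub_self, Nat.add_sub_cancel, if_neg (Nat.succ_ne_zero r)]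
  field_simp
  ring

theorem occClosedForm_eq (k q : ℕ) : ∀ N : ℕ,
    2 * occClosedForm k (N + (q + 1)) (q + 1)
      = ((N + (q + 1)).choose (q + 1) : ℚ) * pairExt k 0 N - weightedPairExt k q N := by
  induction q with
  | zero =>
    intro N
    rw [occClosedForm_succ _ _ _ (by omega), zero_add, Nat.add_sub_cancel, occClosedForm_zero]
    linarith [two_mul_weightedPairExt_zero k N]
  | succ q ih =>
    intro N
    have h := ih (N + 1)
    rw [show N + 1 + (q + 1) = N + (q + 1 + 1) by ring] at h
    have h2 := two_mul_weightedPairExt_succ k q N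
    rw [show N + 1 + (q + 1) = N + (q + 1 + 1) by ring] at h2
    rw [occClosedForm_succ _ _ _ (by omega), Nat.add_sub_cancel]
    linarith

/-- Strictly increasing `q`-tuples of elements of `s`. -/
noncomputable def strictMonoTuples (q : ℕ) (s : Finset ℕ) : Finset (Fin q → ℕ) :=
  (Fintype.piFinset fun _ => s).filter StrictMono

theorem mem_strictMonoTuples {q : ℕ} {s : Finset ℕ} {i : Fin q → ℕ} :
    i ∈ strictMonoTuples q s ↔ StrictMono i ∧ ∀ t, i t ∈ s := by
  rw [strictMonoTuples, Finset.mem_filter, Fintype.mem_piFinset, and_comm]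

theorem card_strictMonoTuples (q : ℕ) (s : Finset ℕ) :
    (strictMonoTuples q s).card = s.card.choose q := by
  rw [← Finset.card_powersetCard]
  refine Finset.card_bij (fun i _ => Finset.univ.image i) ?_ ?_ ?_
  · intro i hi
    rw [mem_strictMonoTuples] at hi
    rw [Finset.mem_powersetCard, Finset.card_image_of_injective _ hi.1.injective]
    refine ⟨?_, by simp⟩
    rw [Finset.image_subset_iff]
    exact fun t _ => hi.2 t
  · intro i hi j hj h
    rw [mem_strictMonoTuples] at hi hj
    refine (hi.1.range_inj hj.1).1 ?_
    simpa using congrArg (fun u : Finset ℕ => (u : Set ℕ)) h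
  · intro u hu
    rw [Finset.mem_powersetCard] at hu
    refine ⟨u.orderEmbOfFin hu.2, mem_strictMonoTuples.2 ⟨(u.orderEmbOfFin hu.2).strictMono,
      fun t => hu.1 (u.orderEmbOfFin_mem hu.2 t)⟩, ?_⟩
    exact Finset.image_orderEmbOfFin_univ u hu.2

theorem card_strictMonoTuples_filter_zero (q n m : ℕ) (hm : m ∈ seg n) :
    ((strictMonoTuples (q + 1) (seg n)).filter fun i => i 0 = m).card = (n - m).choose q := by
  rw [← Nat.card_Ioc, ← card_strictMonoTuples]
  rw [seg, Finset.mem_Icc] at hm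
  refine Finset.card_nbij' (fun i => Fin.tail i) (fun i => Fin.cons m i) ?_ ?_ ?_ ?_
  · intro i hi
    simp only [Finset.coe_filter, Set.mem_ofPred_eq, mem_strictMonoTuples, seg,
      Finset.mem_Icc] at hi
    rw [Finset.mem_coe, mem_strictMonoTuples]
    obtain ⟨⟨hmono, hseg⟩, rfl⟩ := hi
    exact ⟨hmono.comp Fin.strictMono_succ, fun t =>
      Finset.mem_Ioc.2 ⟨hmono (Fin.succ_pos t), (hseg t.succ).2⟩⟩
  · intro i hi
    rw [Finset.mem_coe, mem_strictMonoTuples] at hi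
    simp only [Finset.mem_Ioc] at hi
    simp only [Finset.coe_filter, Set.mem_ofPred_eq, mem_strictMonoTuples, seg, Finset.mem_Icc,
      Fin.cons_zero, and_true]
    refine ⟨?_, ?_⟩
    · intro s t hst
      cases t using Fin.cases with
      | zero => exact absurd hst (Fin.not_lt_zero s)
      | succ t =>
        cases s using Fin.cases with
        | zero => simpa using (hi.2 t).1
        | succ s => simpa using hi.1 (Fin.succ_lt_succ_iff.1 hst)
    · intro t
      cases t using Fin.cases with
      | zero => simpa using hm
      | succ t =>
        have := hi.2 t
        simp only [Fin.cons_succ]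
        omega
  · intro i hi
    simp only [Finset.coe_filter, Set.mem_ofPred_eq] at hi
    rw [← hi.2]
    exact Fin.cons_self_tail i
  · intro i _
    exact Fin.tail_cons (α := fun _ => ℕ) m i

theorem le_of_strictMono_seg {q N : ℕ} {i : Fin (q + 1) → ℕ}
    (hi : i ∈ strictMonoTuples (q + 1) (seg (N + (q + 1)))) : i 0 - 1 ≤ N := by
  rw [mem_strictMonoTuples] at hi
  have hc : (Finset.univ.image i).card ≤ (Finset.Icc (i 0) (N + (q + 1))).card := by
    refine Finset.card_le_card (Finset.image_subset_iff.2 fun t _ => Finset.mem_Icc.2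
      ⟨hi.1.monotone (Fin.zero_le t), (Finset.mem_Icc.1 (hi.2 t)).2⟩)
  rw [Finset.card_image_of_injective _ hi.1.injective, Finset.card_univ, Fintype.card_fin,
    Nat.card_Icc] at hc
  omega

theorem sum_strictMonoTuples (q N : ℕ) (f : ℕ → ℕ → ℚ) :
    ∑ i ∈ strictMonoTuples (q + 1) (seg (N + (q + 1))), f (i 0 - 1) (N - (i 0 - 1))
      = ∑ p ∈ Finset.HasAntidiagonal.antidiagonal N, ((p.2 + q).choose q : ℚ) * f p.1 p.2 := by
  rw [← Finset.sum_fiberwise_of_maps_to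
    (g := fun i : Fin (q + 1) → ℕ => (i 0 - 1, N - (i 0 - 1)))
    (t := Finset.HasAntidiagonal.antidiagonal N)]
  · refine Finset.sum_congr rfl fun p hp => ?_
    rw [Finset.HasAntidiagonal.mem_antidiagonal] at hp
    have hf : ((strictMonoTuples (q + 1) (seg (N + (q + 1)))).filter
        fun i : Fin (q + 1) → ℕ => (i 0 - 1, N - (i 0 - 1)) = p)
        = (strictMonoTuples (q + 1) (seg (N + (q + 1)))).filter fun i => i 0 = p.1 + 1 := by
      refine Finset.filter_congr fun i hi => ?_
      have h0 := Finset.mem_Icc.1 ((mem_strictMonoTuples.1 hi).2 0)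
      rw [Prod.ext_iff]
      simp only
      omega
    have hc := card_strictMonoTuples_filter_zero q (N + (q + 1)) (p.1 + 1)
      (Finset.mem_Icc.2 ⟨by omega, by omega⟩)
    rw [show N + (q + 1) - (p.1 + 1) = p.2 + q by omega] at hc
    rw [← hc, ← hf, ← nsmul_eq_mul, ← Finset.sum_const]
    refine Finset.sum_congr rfl fun i hi => ?_
    rw [← (Finset.mem_filter.1 hi).2]
  · intro i hi
    rw [Finset.HasAntidiagonal.mem_antidiagonal]
    exact Nat.add_sub_of_le (le_of_strictMono_seg hi)

theorem IsPartition.rgf_eq {P : Finset (Finset ℕ)} {S X : Finset ℕ} (h : IsPartition P S)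
    (hX : X ∈ P) {x : ℕ} (hx : x ∈ X) :
    rgf P x = (P.filter fun B => B.min ≤ X.min).card := by
  have hb : blockOf P x = X := by
    have : (P.filter fun B => x ∈ B) = {X} := by
      ext B
      rw [Finset.mem_filter, Finset.mem_singleton]
      exact ⟨fun hB => h.eq_of_mem hB.1 hX hB.2 hx, fun e => e ▸ ⟨hX, hx⟩⟩
    rw [blockOf, this, Finset.singleton_biUnion, id]
  rw [rgf, hb]

theorem IsPartition.rgf_lt_rgf {P : Finset (Finset ℕ)} {S X Y : Finset ℕ} (h : IsPartition P S)
    (hX : X ∈ P) (hY : Y ∈ P) {x y : ℕ} (hx : x ∈ X) (hy : y ∈ Y) (hlt : X.min < Y.min) :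
    rgf P x < rgf P y := by
  rw [h.rgf_eq hX hx, h.rgf_eq hY hy]
  refine Finset.card_lt_card (Finset.ssubset_iff_of_subset ?_ |>.2 ⟨Y, ?_, ?_⟩)
  · exact Finset.monotone_filter_right _ fun B _ hB => hB.trans hlt.le
  · exact Finset.mem_filter.2 ⟨hY, le_rfl⟩
  · exact fun hm => (Finset.mem_filter.1 hm).2.not_gt hlt

theorem IsPartition.min_injOn {P : Finset (Finset ℕ)} {S X Y : Finset ℕ} (h : IsPartition P S)
    (hX : X ∈ P) (hY : Y ∈ P) {x : ℕ} (hx : x ∈ X) (hmin : X.min = Y.min) : X = Y := by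
  obtain ⟨m, hm⟩ := Finset.min_of_mem hx
  exact h.eq_of_mem hX hY (Finset.mem_of_min hm) (Finset.mem_of_min (hmin ▸ hm))

theorem IsPartition.rgf_lt_rgf_iff {P : Finset (Finset ℕ)} {S X Y : Finset ℕ}
    (h : IsPartition P S) (hX : X ∈ P) (hY : Y ∈ P) {x y : ℕ} (hx : x ∈ X) (hy : y ∈ Y) :
    rgf P x < rgf P y ↔ X.min < Y.min := by
  refine ⟨fun hlt => ?_, h.rgf_lt_rgf hX hY hx hy⟩
  by_contra hn
  rcases (not_lt.1 hn).lt_or_eq with h1 | h1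
  · exact (h.rgf_lt_rgf hY hX hy hx h1).not_gt hlt
  · obtain rfl := h.min_injOn hY hX hy h1
    rw [h.rgf_eq hX hx, h.rgf_eq hX hy] at hlt
    exact hlt.false

theorem IsPartition.exists_rgf_iff {P : Finset (Finset ℕ)} {S : Finset ℕ} (h : IsPartition P S)
    {r : ℕ} {σ : Fin r → ℕ} (hσ : TwoPattern σ) {i : Fin r → ℕ} (hi : ∀ t, i t ∈ S) :
    (∃ a b : ℕ, a < b ∧ ∀ t, (σ t = 1 → rgf P (i t) = a) ∧ (σ t = 2 → rgf P (i t) = b))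
      ↔ ∃ X ∈ P, ∃ Y ∈ P, X.min < Y.min ∧ (Finset.univ.filter (σ · = 1)).image i ⊆ X
        ∧ (Finset.univ.filter (σ · = 2)).image i ⊆ Y := by
  obtain ⟨-, ⟨t₁, ht₁⟩, t₂, ht₂⟩ := hσ
  simp only [Finset.image_subset_iff, Finset.mem_filter, Finset.mem_univ, true_and]
  constructor
  · rintro ⟨a, b, hab, H⟩
    obtain ⟨X, hX, hxX⟩ := h.exists_mem (hi t₁)
    obtain ⟨Y, hY, hyY⟩ := h.exists_mem (hi t₂)
    have key : ∀ {s t Z}, Z ∈ P → i s ∈ Z → rgf P (i s) = rgf P (i t) → i t ∈ Z := by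
      intro s t Z hZ hs hst
      obtain ⟨W, hW, ht⟩ := h.exists_mem (hi t)
      have e := h.min_injOn hW hZ ht (le_antisymm
        (not_lt.1 fun hlt => hst.not_lt ((h.rgf_lt_rgf_iff hZ hW hs ht).2 hlt))
        (not_lt.1 fun hlt => hst.not_gt ((h.rgf_lt_rgf_iff hW hZ ht hs).2 hlt)))
      exact e ▸ ht
    refine ⟨X, hX, Y, hY, (h.rgf_lt_rgf_iff hX hY hxX hyY).1 ?_,
      fun t ht => key hX hxX (((H t₁).1 ht₁).trans ((H t).1 ht).symm),
      fun t ht => key hY hyY (((H t₂).2 ht₂).trans ((H t).2 ht).symm)⟩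
    rwa [(H t₁).1 ht₁, (H t₂).2 ht₂]
  · rintro ⟨X, hX, Y, hY, hlt, hA, hB⟩
    refine ⟨rgf P (i t₁), rgf P (i t₂), h.rgf_lt_rgf hX hY (hA t₁ ht₁) (hB t₂ ht₂) hlt,
      fun t => ⟨fun ht => ?_, fun ht => ?_⟩⟩
    · rw [h.rgf_eq hX (hA t ht), h.rgf_eq hX (hA t₁ ht₁)]
    · rw [h.rgf_eq hY (hB t ht), h.rgf_eq hY (hB t₂ ht₂)]

theorem sum_occ_eq_sum_card {r : ℕ} {σ : Fin r → ℕ} (hσ : TwoPattern σ) (n k : ℕ) :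
    ∑ P ∈ partitionsK n k, occ n σ P
      = ∑ i ∈ strictMonoTuples r (seg n), ((partsOf (seg n) k).filter fun P =>
          ∃ X ∈ P, ∃ Y ∈ P, X.min < Y.min ∧ (Finset.univ.filter (σ · = 1)).image i ⊆ X
            ∧ (Finset.univ.filter (σ · = 2)).image i ⊆ Y).card := by
  rw [partitionsK_eq_partsOf]
  simp only [Finset.card_filter]
  rw [Finset.sum_comm]
  refine Finset.sum_congr rfl fun P hP => ?_
  rw [← Finset.card_filter, occ]
  refine Nat.subtype_card _ fun i => ?_
  rw [Finset.mem_filter, mem_strictMonoTuples, and_assoc]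
  refine and_congr_right fun _ => and_congr_right fun hi => ?_
  exact ((mem_partsOf.1 hP).1.exists_rgf_iff hσ hi).symm

theorem two_mul_card_blocks_containing_tuple {q N : ℕ} {σ : Fin (q + 1) → ℕ} (hσ : TwoPattern σ)
    (hσ0 : σ 0 = 2) {i : Fin (q + 1) → ℕ}
    (hi : i ∈ strictMonoTuples (q + 1) (seg (N + (q + 1)))) (k : ℕ) :
    2 * ((partsOf (seg (N + (q + 1))) (k + 2)).filter fun P =>
        ∃ X ∈ P, ∃ Y ∈ P, X.min < Y.min ∧ (Finset.univ.filter (σ · = 1)).image i ⊆ X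
          ∧ (Finset.univ.filter (σ · = 2)).image i ⊆ Y).card
      + pairExt k (i 0 - 1) (N - (i 0 - 1)) = pairExt k 0 N := by
  have hN := le_of_strictMono_seg hi
  rw [mem_strictMonoTuples] at hi
  obtain ⟨hmono, hseg⟩ := hi
  have h0 : ∀ t, i 0 ≤ i t := fun t => hmono.monotone (Fin.zero_le t)
  have hsub : ∀ s : Finset (Fin (q + 1)), s.image i ⊆ seg (N + (q + 1)) :=
    fun s => Finset.image_subset_iff.2 fun t _ => hseg t
  have hge : ∀ s : Finset (Fin (q + 1)), ∀ x ∈ s.image i, i 0 ≤ x :=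
    fun s => Finset.forall_mem_image.2 fun t _ => h0 t
  have hunion : (Finset.univ.filter (σ · = 1)).image i ∪ (Finset.univ.filter (σ · = 2)).image i
      = Finset.univ.image i := by
    rw [← Finset.image_union, ← Finset.filter_or, Finset.filter_true_of_mem fun t _ => hσ.1 t]
  have hcard : (seg (N + (q + 1)) \ Finset.univ.image i).card = N := by
    rw [Finset.card_sdiff_of_subset (hsub _), Finset.card_image_of_injective _ hmono.injective,
      seg, Nat.card_Icc, Finset.card_univ, Fintype.card_fin]
    omega
  have hlow : ((seg (N + (q + 1)) \ Finset.univ.image i).filter fun x => x < i 0).card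
      = i 0 - 1 := by
    have : ((seg (N + (q + 1)) \ Finset.univ.image i).filter fun x => x < i 0)
        = Finset.Ico 1 (i 0) := by
      ext x
      have h1 := Finset.mem_Icc.1 (hseg 0)
      simp only [Finset.mem_filter, Finset.mem_sdiff, seg, Finset.mem_Icc, Finset.mem_Ico]
      exact ⟨fun H => ⟨H.1.1.1, H.2⟩, fun H => ⟨⟨⟨H.1, by omega⟩, fun hx =>
        (hge _ x hx).not_gt H.2⟩, H.2⟩⟩
    rw [this, Nat.card_Ico]
  have hhigh := Finset.card_filter_add_card_filter_not (s := seg (N + (q + 1)) \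
    Finset.univ.image i) (fun x => x < i 0)
  rw [hlow, hcard] at hhigh
  have hdisj : Disjoint ((Finset.univ.filter (σ · = 1)).image i)
      ((Finset.univ.filter (σ · = 2)).image i) := by
    rw [Finset.disjoint_image hmono.injective, Finset.disjoint_filter]
    intro t _ h1 h2
    omega
  obtain ⟨t₁, ht₁⟩ := hσ.2.1
  have := two_mul_card_partsOf_filter_min_lt (S := seg (N + (q + 1))) (m := i 0)
    (A := (Finset.univ.filter (σ · = 1)).image i) (B := (Finset.univ.filter (σ · = 2)).image i)
    ⟨i t₁, Finset.mem_image_of_mem i (by simpa using ht₁)⟩ (hsub _) (hsub _) hdisj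
    (Finset.mem_image_of_mem i (by simpa using hσ0)) (hge _) (hge _) k (i 0 - 1)
    (N - (i 0 - 1)) (by rw [hunion, hlow]) (by rw [hunion]; omega)
  rwa [Nat.add_sub_of_le hN] at this

/-- exact total number of occurrences over `Π_n^k` of a 2-pattern with
first letter 2. -/
theorem occ2_mean_over_partitionsK {r : ℕ} (hr : 0 < r) (σ : Fin r → ℕ)
    (hσ : TwoPattern σ) (hσ1 : σ ⟨0, hr⟩ = 2) (n k : ℕ) (hn : r ≤ n) (hk : 2 ≤ k) :
    (∑ π ∈ partitionsK n k, (occ n σ π : ℚ))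
      = (∑ j ∈ Finset.range (r+1),
          ((-1 : ℚ)^(r-j) / 2^(r-j+1)) *
              ((n.choose j : ℚ) + (1/2) * (if j = 0 then 0 else (n.choose (j-1) : ℚ)))
            * (stirling (n+2-j) k : ℚ))
        - (1/2) * (n.choose r : ℚ) * (stirling (n+1-r) k : ℚ)
        + ((-1 : ℚ)^(r+1) / 2^(r+1)) * (stirling n (k-2) : ℚ) := by
  obtain ⟨k, rfl⟩ := Nat.exists_eq_add_of_le' hk
  obtain ⟨q, rfl⟩ := Nat.exists_eq_add_of_le' hr
  obtain ⟨N, rfl⟩ := Nat.exists_eq_add_of_le' hn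
  simp only [stirling_eq_stirlingRec, Nat.add_sub_cancel]
  change _ = occClosedForm k (N + (q + 1)) (q + 1)
  have hsum : 2 * ((∑ P ∈ partitionsK (N + (q + 1)) (k + 2), occ (N + (q + 1)) σ P : ℕ) : ℚ)
        + weightedPairExt k q N
      = ((N + (q + 1)).choose (q + 1) : ℚ) * pairExt k 0 N := by
    rw [sum_occ_eq_sum_card hσ, weightedPairExt,
      ← sum_strictMonoTuples q N (fun l h => (pairExt k l h : ℚ)), Nat.cast_sum, Finset.mul_sum,
      ← Finset.sum_add_distrib]
    have hcard : (N + (q + 1)).choose (q + 1)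
        = (strictMonoTuples (q + 1) (seg (N + (q + 1)))).card := by
      rw [card_strictMonoTuples, seg, Nat.card_Icc, Nat.add_sub_cancel]
    rw [hcard, ← nsmul_eq_mul, ← Finset.sum_const]
    refine Finset.sum_congr rfl fun i hi => ?_
    exact_mod_cast two_mul_card_blocks_containing_tuple hσ hσ1 hi k
  have hclosed := occClosedForm_eq k q N
  push_cast at hsum
  linarith
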